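/- Fix n ≥ 1 and M ≥ 2. Let p_{j|i} (for i ≠ j, 1 ≤ i, j ≤ M) be real numbers with p_{j|i} > 0 and Σ_{j≠i} p_{j|i} = 1 for each i. For points y₁, …, y_M ∈ ℝ^n define the conditional probabilities q_{j|i}(y) = exp(−‖y_i − y_j‖²) / Σ_{k≠i} exp(−‖y_i − y_k‖²), and the cost C(y) = Σ_i Σ_{j≠i} p_{j|i} · log(p_{j|i}/q_{j|i}(y)). Then, for each index i, the function z ↦ C(y₁, …, y_{i−1}, z, y_{i+1}, …, y_M) is differentiable at z = y_i, and its gradient there equals 2 · Σ_{j≠i} (p_{j|i} − q_{j|i}(y) + p_{i|j} − q_{i|j}(y)) · (y_i − y_j). -/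

import Mathlib

/-- Derivative of a Kullback–Leibler divergence `∑ p log (p / q)` from fixed weights `p` to the
Gibbs distribution `q b = exp (-f b) / ∑ c, exp (-f c)`. -/
theorem HasFDerivAt.sum_mul_log_div_gibbs {E ι : Type*} [NormedAddCommGroup E] [NormedSpace ℝ E]
    {s : Finset ι} {p : ι → ℝ} (hpos : ∀ b ∈ s, 0 < p b) (hsum : ∑ b ∈ s, p b = 1)
    {f : ι → E → ℝ} {f' : ι → E →L[ℝ] ℝ} {x : E} (hf : ∀ b ∈ s, HasFDerivAt (f b) (f' b) x) :
    HasFDerivAt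
      (fun z => ∑ b ∈ s, p b * Real.log (p b /
        (Real.exp (-f b z) / ∑ c ∈ s, Real.exp (-f c z))))
      (∑ b ∈ s, (p b - Real.exp (-f b x) / ∑ c ∈ s, Real.exp (-f c x)) • f' b) x := by
  have hs : s.Nonempty := by
    rw [Finset.nonempty_iff_ne_empty]
    rintro rfl
    simp at hsum
  have hZ : ∀ z, 0 < ∑ c ∈ s, Real.exp (-f c z) := fun z =>
    Finset.sum_pos (fun c _ => Real.exp_pos _) hs
  have hfun : (fun z => ∑ b ∈ s, p b * Real.log (p b /
        (Real.exp (-f b z) / ∑ c ∈ s, Real.exp (-f c z)))) =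
      fun z => (∑ b ∈ s, (p b * Real.log (p b) + p b * f b z)) +
        Real.log (∑ c ∈ s, Real.exp (-f c z)) := by
    funext z
    rw [← one_mul (Real.log (∑ c ∈ s, Real.exp (-f c z))), ← hsum, Finset.sum_mul,
      ← Finset.sum_add_distrib]
    refine Finset.sum_congr rfl fun b hb => ?_
    rw [Real.log_div (hpos b hb).ne' (div_pos (Real.exp_pos _) (hZ z)).ne',
      Real.log_div (Real.exp_pos _).ne' (hZ z).ne', Real.log_exp]
    ring
  rw [hfun]
  have hlin : HasFDerivAt (fun z => ∑ b ∈ s, (p b * Real.log (p b) + p b * f b z))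
      (∑ b ∈ s, p b • f' b) x :=
    HasFDerivAt.fun_sum fun b hb => ((hf b hb).const_mul (p b)).const_add _
  have hlog := (HasFDerivAt.fun_sum fun c hc => (hf c hc).fun_neg.exp).log (hZ x).ne'
  refine (hlin.add hlog).congr_fderiv ?_
  rw [Finset.smul_sum, ← Finset.sum_add_distrib]
  refine Finset.sum_congr rfl fun b _ => ?_
  rw [div_eq_inv_mul]
  module

/-- Gradient of the squared distance between two points of a family, as one point moves. -/
theorem hasGradientAt_norm_sq_update_sub {ι E : Type*} [DecidableEq ι] [NormedAddCommGroup E]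
    [InnerProductSpace ℝ E] [CompleteSpace E] (y : ι → E) (i a b : ι) :
    HasGradientAt (fun z => ‖Function.update y i z a - Function.update y i z b‖ ^ 2)
      ((2 * ((if a = i then 1 else 0) - (if b = i then 1 else 0)) : ℝ) • (y a - y b)) (y i) := by
  have hup : ∀ c, HasFDerivAt (fun z => Function.update y i z c)
      ((if c = i then (1 : ℝ) else 0) • ContinuousLinearMap.id ℝ E) (y i) := by
    intro c
    by_cases h : c = i
    · subst h
      simpa [Function.id_def] using hasFDerivAt_id (𝕜 := ℝ) (y c)
    · simpa [h] using hasFDerivAt_const (𝕜 := ℝ) (y c) (y i)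
  rw [hasGradientAt_iff_hasFDerivAt]
  refine ((hup a).sub (hup b)).norm_sq.congr_fderiv ?_
  ext v
  simp only [Function.update_eq_self, smul_apply,
    ContinuousLinearMap.comp_apply, ContinuousLinearMap.id_apply,
    innerSL_apply_apply, InnerProductSpace.toDual_apply_apply, ← sub_smul, real_inner_smul_left,
    real_inner_smul_right, nsmul_eq_mul, Nat.cast_ofNat, Pi.sub_apply]
  ring

/-- A double sum of off-diagonal terms restricted to the pairs that contain `i`, with signs. -/
theorem Finset.sum_sum_sdiff_indicator_sub_smul {ι E : Type*} [Fintype ι] [DecidableEq ι]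
    [AddCommGroup E] [Module ℝ E] (G : ι → ι → E) (i : ι) :
    ∑ a, ∑ b ∈ Finset.univ \ {a},
        ((if a = i then (1 : ℝ) else 0) - (if b = i then 1 else 0)) • G a b =
      ∑ j ∈ Finset.univ \ {i}, (G i j - G j i) := by
  have hfull : ∀ F : ι → E, ∀ a, F a = 0 → ∑ b ∈ Finset.univ \ {a}, F b = ∑ b, F b := by
    intro F a h
    refine Finset.sum_subset (Finset.subset_univ _) fun b _ hb => ?_
    obtain rfl : b = a := by simpa using hb
    exact h
  rw [Finset.sum_congr rfl fun a _ => hfull _ a (by simp), hfull _ i (by simp)]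
  simp [sub_smul, Finset.sum_sub_distrib, ite_smul]

/-- Gradient of the original (asymmetric) SNE cost: with fixed conditional probabilities
`p b|a` (written `p a b`), positive for `a ≠ b` and summing to `1` over `b ≠ a` for each `a`,
embedded points `y₁, …, y_M ∈ ℝ^n`, Gaussian conditional probabilities
`q_{b|a}(w) = exp(-‖w_a - w_b‖²) / Σ_{c≠a} exp(-‖w_a - w_c‖²)` and cost
`C(w) = Σ_a Σ_{b≠a} p_{b|a} log(p_{b|a}/q_{b|a}(w))`, the map `z ↦ C(y[i := z])` has gradient
`2 Σ_{j≠i} (p_{j|i} - q_{j|i}(y) + p_{i|j} - q_{i|j}(y)) (y_i - y_j)` at `z = y_i`. -/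
theorem stmt_12 (n M : ℕ) (hn : 1 ≤ n) (hM : 2 ≤ M)
    (p : Fin M → Fin M → ℝ)
    (hpos : ∀ i j, i ≠ j → 0 < p i j)
    (hsum : ∀ i, ∑ j ∈ Finset.univ \ {i}, p i j = 1)
    (y : Fin M → EuclideanSpace ℝ (Fin n)) (i : Fin M) :
    HasGradientAt
      (fun z : EuclideanSpace ℝ (Fin n) =>
        ∑ a, ∑ b ∈ Finset.univ \ {a},
          p a b * Real.log (p a b /
            (Real.exp (-‖Function.update y i z a - Function.update y i z b‖^2) /
              ∑ c ∈ Finset.univ \ {a},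
                Real.exp (-‖Function.update y i z a - Function.update y i z c‖^2))))
      ((2:ℝ) • ∑ j ∈ Finset.univ \ {i},
        ((p i j -
            Real.exp (-‖y i - y j‖^2) /
              ∑ c ∈ Finset.univ \ {i}, Real.exp (-‖y i - y c‖^2)) +
          (p j i -
            Real.exp (-‖y j - y i‖^2) /
              ∑ c ∈ Finset.univ \ {j}, Real.exp (-‖y j - y c‖^2))) • (y i - y j))
      (y i) := by
  have hrow : ∀ a, HasFDerivAt _ _ (y i) := fun a =>
    HasFDerivAt.sum_mul_log_div_gibbs (s := Finset.univ \ {a}) (p := p a)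
      (fun b hb => hpos a b (by simpa [eq_comm] using hb)) (hsum a)
      (fun b _ => (hasGradientAt_norm_sq_update_sub y i a b).hasFDerivAt)
  rw [hasGradientAt_iff_hasFDerivAt]
  refine (HasFDerivAt.fun_sum fun a _ => hrow a).congr_fderiv ?_
  have hdual : ∀ (c : ℝ) (v : EuclideanSpace ℝ (Fin n)),
      c • InnerProductSpace.toDual ℝ _ v = InnerProductSpace.toDual ℝ _ (c • v) := by
    intro c v
    simp
  simp only [hdual, ← map_sum, Function.update_eq_self]
  congr 1
  simp only [mul_comm (2 : ℝ), mul_smul, smul_comm _ (2 : ℝ)]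
  simp only [smul_comm _ ((if _ then (1 : ℝ) else 0) - _)]
  rw [Finset.sum_sum_sdiff_indicator_sub_smul, Finset.smul_sum]
  refine Finset.sum_congr rfl fun j _ => ?_
  module
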